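/- Let P be a polynomial with complex coefficients of degree n, and let α, β be complex numbers with |α| ≤ 1 and |β| ≤ 1. Then for every real R ≥ 1 and every complex z with |z| ≥ 1, |P(Rz) − α·P(z) + β(((R+1)/2)^n − |α|)·P(z)| ≤ |R^n − α + β(((R+1)/2)^n − |α|)| · |z|^n · max_{|w|=1} |P(w)|. -/

import Mathlib

open Polynomial

/-- The modified Smirnov operator: S̃ₐ[P](z) = (1+az)·P′(z) − n·a·P(z). -/
noncomputable def smirnov (n : ℕ) (a : ℂ) (P : Polynomial ℂ) (z : ℂ) : ℂ :=
  (1 + a * z) * P.derivative.eval z - (n : ℂ) * a * P.eval z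

/-- The maximum of ‖P‖ on the unit circle. -/
noncomputable def maxCircle (P : Polynomial ℂ) : ℝ :=
  sSup {y : ℝ | ∃ w : ℂ, ‖w‖ = 1 ∧ y = ‖P.eval w‖}

/-- For `‖w‖ ≤ ‖z‖`, the point `R z` is farther from `w` than `z` by a factor `(R + 1) / 2`. -/
lemma half_add_one_mul_norm_sub_le {R : ℝ} (hR : 1 ≤ R) {z w : ℂ} (h : ‖w‖ ≤ ‖z‖) :
    (R + 1) / 2 * ‖z - w‖ ≤ ‖(R : ℂ) * z - w‖ := by
  refine (pow_le_pow_iff_left₀ (by positivity) (norm_nonneg _) two_ne_zero).1 ?_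
  have h2 : ‖w‖ ^ 2 ≤ ‖z‖ ^ 2 := by gcongr
  rw [mul_pow]
  simp only [Complex.sq_norm, Complex.normSq_apply, Complex.sub_re, Complex.sub_im,
    Complex.mul_re, Complex.mul_im, Complex.ofReal_re, Complex.ofReal_im] at h2 ⊢
  nlinarith [mul_nonneg (mul_nonneg (sub_nonneg.2 hR) (by linarith : 0 ≤ R + 1))
    (sub_nonneg.2 h2), mul_nonneg (sq_nonneg (R - 1)) (sq_nonneg (z.re + w.re)),
    mul_nonneg (sq_nonneg (R - 1)) (sq_nonneg (z.im + w.im))]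

lemma half_add_one_pow_mul_norm_eval_le {R : ℝ} (hR : 1 ≤ R) {z : ℂ} (F : Polynomial ℂ)
    (hF : ∀ w ∈ F.roots, ‖w‖ ≤ ‖z‖) :
    ((R + 1) / 2) ^ F.natDegree * ‖F.eval z‖ ≤ ‖F.eval ((R : ℂ) * z)‖ := by
  have key : ∀ s : Multiset ℂ, (∀ w ∈ s, ‖w‖ ≤ ‖z‖) →
      ((R + 1) / 2) ^ s.card * ‖(s.map fun w => z - w).prod‖
        ≤ ‖(s.map fun w => (R : ℂ) * z - w).prod‖ := by
    intro s
    induction s using Multiset.induction with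
    | empty => simp
    | cons a s ih =>
      intro hs
      have h1 := half_add_one_mul_norm_sub_le hR (hs a (Multiset.mem_cons_self a s))
      have h2 := ih fun w hw => hs w (Multiset.mem_cons_of_mem hw)
      simp only [Multiset.map_cons, Multiset.prod_cons, Multiset.card_cons, norm_mul]
      calc _ = ((R + 1) / 2 * ‖z - a‖) *
            (((R + 1) / 2) ^ s.card * ‖(s.map fun w => z - w).prod‖) := by ring
        _ ≤ _ := by gcongr
  have hs := IsAlgClosed.splits F
  rw [hs.eval_eq_prod_roots, hs.eval_eq_prod_roots, hs.natDegree_eq_card_roots, norm_mul, norm_mul,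
    mul_left_comm]
  gcongr
  exact key _ hF

lemma norm_eval_le_maxCircle (P : Polynomial ℂ) {w : ℂ} (hw : ‖w‖ = 1) :
    ‖P.eval w‖ ≤ maxCircle P := by
  refine le_csSup ?_ ⟨w, hw, rfl⟩
  have hc := (isCompact_sphere (0 : ℂ) 1).bddAbove_image
    (f := fun w => ‖P.eval w‖) P.continuous.norm.continuousOn
  refine hc.mono ?_
  rintro y ⟨w, hw, rfl⟩
  exact ⟨w, by simpa using hw, rfl⟩

lemma norm_eval_reverse_le_maxCircle (P : Polynomial ℂ) {w : ℂ} (hw : ‖w‖ ≤ 1) :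
    ‖P.reverse.eval w‖ ≤ maxCircle P := by
  refine Complex.norm_le_of_forall_mem_frontier_norm_le (U := Metric.ball (0 : ℂ) 1)
    Metric.isBounded_ball P.reverse.differentiable.diffContOnCl ?_ ?_
  · intro u hu
    rw [frontier_ball _ one_ne_zero, mem_sphere_zero_iff_norm] at hu
    have hu0 : u ≠ 0 := norm_ne_zero_iff.1 (by simp [hu])
    let _ : Invertible u⁻¹ := invertibleOfNonzero (inv_ne_zero hu0)
    have h := eval₂_reverse_mul_pow (RingHom.id ℂ) u⁻¹ P
    rw [invOf_eq_inv, inv_inv] at h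
    have h' := congrArg norm h
    rw [norm_mul, norm_pow, norm_inv, hu, inv_one, one_pow, mul_one] at h'
    exact h'.trans_le (norm_eval_le_maxCircle P (by simp [hu]))
  · rw [closure_ball _ one_ne_zero]
    simpa using hw

/-- The growth of a polynomial outside the unit disc is at most that of its leading monomial. -/
lemma norm_eval_le_pow_mul_maxCircle (P : Polynomial ℂ) {z : ℂ} (hz : 1 ≤ ‖z‖) :
    ‖P.eval z‖ ≤ maxCircle P * ‖z‖ ^ P.natDegree := by
  have hz0 : z ≠ 0 := norm_ne_zero_iff.1 (by linarith)
  let _ : Invertible z := invertibleOfNonzero hz0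
  have h := congrArg norm (eval₂_reverse_mul_pow (RingHom.id ℂ) z P)
  rw [invOf_eq_inv, norm_mul, norm_pow] at h
  refine h.symm.trans_le ?_
  gcongr
  refine norm_eval_reverse_le_maxCircle P ?_
  rw [norm_inv]
  exact inv_le_one_of_one_le₀ hz

lemma norm_leadingCoeff_le_maxCircle (P : Polynomial ℂ) : ‖P.leadingCoeff‖ ≤ maxCircle P := by
  have h := norm_eval_reverse_le_maxCircle P (w := 0) (by simp)
  rwa [← coeff_zero_eq_eval_zero, coeff_zero_reverse] at h

lemma norm_eval_add_mul_eval_le_of_lt (P : Polynomial ℂ) {R : ℝ} (hR : 1 ≤ R) {z c : ℂ}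
    (hz : 1 ≤ ‖z‖) (hc : ‖c‖ < ((R + 1) / 2) ^ P.natDegree) :
    ‖P.eval ((R : ℂ) * z) + c * P.eval z‖
      ≤ ‖(R : ℂ) ^ P.natDegree + c‖ * ‖z‖ ^ P.natDegree * maxCircle P := by
  set n := P.natDegree with hn
  have hz0 : z ≠ 0 := norm_ne_zero_iff.1 (by linarith)
  have hRc : (R : ℂ) ^ n + c ≠ 0 := by
    intro h
    have h1 : ‖c‖ = R ^ n := by
      rw [← neg_eq_of_add_eq_zero_right h, norm_neg, norm_pow, Complex.norm_of_nonneg (by linarith)]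
    have h2 : ((R + 1) / 2) ^ n ≤ R ^ n := by gcongr; linarith
    linarith
  have hD : ((R : ℂ) ^ n + c) * z ^ n ≠ 0 := mul_ne_zero hRc (pow_ne_zero _ hz0)
  by_contra! hlt
  set μ := (P.eval ((R : ℂ) * z) + c * P.eval z) / (((R : ℂ) ^ n + c) * z ^ n) with hμ
  have hμM : maxCircle P < ‖μ‖ := by
    rw [hμ, norm_div, lt_div_iff₀ (norm_pos_iff.2 hD), norm_mul, norm_pow]
    linarith
  set F : Polynomial ℂ := C μ * X ^ n - P with hF
  have hFeval : ∀ w, F.eval w = μ * w ^ n - P.eval w := by simp [hF]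
  have hFne : ∀ w : ℂ, 1 ≤ ‖w‖ → F.eval w ≠ 0 := by
    intro w hw h
    rw [hFeval, sub_eq_zero] at h
    have h1 := norm_eval_le_pow_mul_maxCircle P hw
    rw [← h, norm_mul, norm_pow] at h1
    exact absurd (le_of_mul_le_mul_right h1 (by positivity)) hμM.not_ge
  have hFdeg : F.natDegree = n := by
    refine natDegree_eq_of_le_of_coeff_ne_zero ?_ ?_
    · exact (natDegree_sub_le _ _).trans (max_le (natDegree_C_mul_X_pow_le _ _) le_rfl)
    · rw [hF, coeff_sub, coeff_C_mul_X_pow, if_pos rfl, sub_ne_zero]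
      rintro h
      have := norm_leadingCoeff_le_maxCircle P
      rw [leadingCoeff, ← hn, ← h] at this
      linarith
  have hgrow := half_add_one_pow_mul_norm_eval_le hR (z := z) F fun w hw => by
    by_contra! hlt'
    exact hFne w (hz.trans hlt'.le) (isRoot_of_mem_roots hw)
  have hzero : F.eval ((R : ℂ) * z) = -c * F.eval z := by
    have : μ * (((R : ℂ) ^ n + c) * z ^ n) = P.eval ((R : ℂ) * z) + c * P.eval z :=
      div_mul_cancel₀ _ hD
    rw [hFeval, hFeval]
    linear_combination this
  rw [hzero, hFdeg, norm_mul, norm_neg] at hgrow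
  exact absurd (le_of_mul_le_mul_right hgrow (norm_pos_iff.2 (hFne z hz))) hc.not_ge

lemma norm_eval_add_mul_eval_le (P : Polynomial ℂ) {R : ℝ} (hR : 1 ≤ R) {z c : ℂ}
    (hz : 1 ≤ ‖z‖) (hc : ‖c‖ ≤ ((R + 1) / 2) ^ P.natDegree) :
    ‖P.eval ((R : ℂ) * z) + c * P.eval z‖
      ≤ ‖(R : ℂ) ^ P.natDegree + c‖ * ‖z‖ ^ P.natDegree * maxCircle P := by
  have hK : ((R + 1) / 2) ^ P.natDegree ≠ 0 := by positivity
  have hmem : c ∈ closure (Metric.ball (0 : ℂ) (((R + 1) / 2) ^ P.natDegree)) := by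
    rw [closure_ball _ hK]
    simpa using hc
  refine closure_minimal (t := {c : ℂ | ‖P.eval ((R : ℂ) * z) + c * P.eval z‖
      ≤ ‖(R : ℂ) ^ P.natDegree + c‖ * ‖z‖ ^ P.natDegree * maxCircle P}) ?_ ?_ hmem
  · intro u hu
    exact norm_eval_add_mul_eval_le_of_lt P hR hz (by simpa using hu)
  · exact isClosed_le (by fun_prop) (by fun_prop)

theorem statement13 (n : ℕ) (P : Polynomial ℂ) (hP : P.natDegree = n)
    (α β : ℂ) (hα : ‖α‖ ≤ 1) (hβ : ‖β‖ ≤ 1)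
    (R : ℝ) (hR : 1 ≤ R) (z : ℂ) (hz : 1 ≤ ‖z‖) :
    ‖P.eval ((R : ℂ) * z) - α * P.eval z
        + β * (((((R + 1) / 2) ^ n - ‖α‖ : ℝ)) : ℂ) * P.eval z‖
      ≤ ‖(R : ℂ) ^ n - α + β * (((((R + 1) / 2) ^ n - ‖α‖ : ℝ)) : ℂ)‖
        * ‖z‖ ^ n * maxCircle P := by
  subst hP
  set K : ℝ := ((R + 1) / 2) ^ P.natDegree
  have hK : 1 ≤ K := one_le_pow₀ (by linarith)
  have hc : ‖-α + β * ((K - ‖α‖ : ℝ) : ℂ)‖ ≤ K := by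
    calc _ ≤ ‖α‖ + ‖β‖ * (K - ‖α‖) := by
          refine (norm_add_le _ _).trans_eq ?_
          rw [norm_neg, norm_mul, Complex.norm_of_nonneg (by linarith)]
      _ ≤ ‖α‖ + 1 * (K - ‖α‖) := by
          gcongr
          linarith
      _ = K := by ring
  convert norm_eval_add_mul_eval_le P hR hz hc using 2
  · ring
  · ring_nf
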